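/- Let e and e′ be edges of a finite simple graph G. Then the projections Θ_e and Θ_{e′} commute: for every tubing T of G, Θ_e(Θ_{e′}(T)) = Θ_{e′}(Θ_e(T)), both being tubings of the graph obtained from G by deleting both e and e′. -/

import Mathlib

/-- A tube of a graph `G`: a nonempty set of vertices whose induced subgraph is connected. -/
def IsTube {V : Type*} (G : SimpleGraph V) (t : Set V) : Prop :=
  t.Nonempty ∧ (G.induce t).Connected

/-- Two tubes are compatible if they are nested or their union is not a tube (far apart). -/
def TubeCompatible {V : Type*} (G : SimpleGraph V) (t u : Set V) : Prop :=
  t ⊆ u ∨ u ⊆ t ∨ ¬ IsTube G (t ∪ u)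

/-- A tubing of `G`: a set of pairwise compatible proper tubes which, when `G` is
disconnected, does not contain every connected-component vertex set of `G`. -/
def IsTubing {V : Type*} (G : SimpleGraph V) (T : Set (Set V)) : Prop :=
  (∀ t ∈ T, IsTube G t ∧ t ≠ Set.univ) ∧
  (∀ t ∈ T, ∀ u ∈ T, TubeCompatible G t u) ∧
  (¬ G.Preconnected → ¬ ∀ c : G.ConnectedComponent, c.supp ∈ T)

/-- The vertex set of the connected component, within the induced subgraph of `H` on `t`,
containing the vertex `v` of `t`. -/
def compSet {V : Type*} (H : SimpleGraph V) (t : Set V) (v : t) : Set V :=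
  Subtype.val '' {w : t | (H.induce t).Reachable v w}

/-- The projection sending a collection `T` of subsets of vertices to the collection of all
vertex sets of connected components (in the graph `H`) of members of `T`. -/
def Theta {V : Type*} (H : SimpleGraph V) (T : Set (Set V)) : Set (Set V) :=
  {c | ∃ t ∈ T, ∃ v : t, c = compSet H t v}

section compSet

variable {V : Type*} {H H' : SimpleGraph V} {s t : Set V}

theorem compSet_subset (H : SimpleGraph V) (t : Set V) (v : t) : compSet H t v ⊆ t := by
  rintro _ ⟨w, -, rfl⟩
  exact w.2

theorem mem_compSet_self (H : SimpleGraph V) (t : Set V) (v : t) : (v : V) ∈ compSet H t v :=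
  ⟨v, SimpleGraph.Reachable.refl v, rfl⟩

theorem compSet_connected (H : SimpleGraph V) (t : Set V) (v : t) :
    (H.induce (compSet H t v)).Connected := by
  refine H.induce_connected_of_patches (v : V) (mem_compSet_self H t v) ?_
  rintro _ ⟨w, ⟨p⟩, rfl⟩
  let q := p.map (SimpleGraph.Embedding.induce t).toHom
  refine ⟨{x | x ∈ q.support}, ?_, q.start_mem_support, q.end_mem_support,
    q.connected_induce_support.preconnected _ _⟩
  intro x hx
  obtain ⟨y, hy, rfl⟩ := List.mem_map.1 (SimpleGraph.Walk.support_map _ p ▸ hx)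
  classical exact ⟨y, ⟨p.takeUntil y hy⟩, rfl⟩

/-- The component of `v` in `t` contains every connected subset of `t` through `v`. -/
theorem subset_compSet (hs : (H.induce s).Connected) (hst : s ⊆ t) (v : t) (hv : (v : V) ∈ s) :
    s ⊆ compSet H t v := fun x hx ↦
  ⟨⟨x, hst hx⟩, (hs.preconnected ⟨v, hv⟩ ⟨x, hx⟩).map (H.induceHomOfLE hst).toHom, rfl⟩

theorem induce_connected_mono (h : H ≤ H') (hs : (H.induce s).Connected) :
    (H'.induce s).Connected :=
  hs.mono (SimpleGraph.comap_monotone _ h)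

theorem compSet_compSet (h : H ≤ H') (v : t) (w : compSet H' t v) :
    compSet H (compSet H' t v) w = compSet H t ⟨w, compSet_subset H' t v w.2⟩ := by
  set w' : t := ⟨w, compSet_subset H' t v w.2⟩
  have hw' : (w' : V) ∈ compSet H t w' := mem_compSet_self H t w'
  refine (subset_compSet (compSet_connected H _ w) ((compSet_subset H _ w).trans
    (compSet_subset H' t v)) w' (mem_compSet_self H _ w)).antisymm
    (subset_compSet (compSet_connected H t w') ?_ w hw')
  have hunion : (H'.induce (compSet H' t v ∪ compSet H t w')).Connected :=
    SimpleGraph.induce_union_connected (compSet_connected H' t v).preconnected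
      (induce_connected_mono h (compSet_connected H t w')).preconnected ⟨w, w.2, hw'⟩
  exact Set.subset_union_right.trans (subset_compSet hunion
    (Set.union_subset (compSet_subset H' t v) (compSet_subset H t w')) v
    (Or.inl (mem_compSet_self H' t v)))

end compSet

section Theta

variable {V : Type*} {G H H' : SimpleGraph V} {T : Set (Set V)}

theorem Theta_Theta (h : H ≤ H') (T : Set (Set V)) : Theta H (Theta H' T) = Theta H T := by
  ext c
  constructor
  · rintro ⟨_, ⟨t, ht, v, rfl⟩, w, rfl⟩
    exact ⟨t, ht, _, compSet_compSet h v w⟩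
  · rintro ⟨t, ht, v, rfl⟩
    exact ⟨_, ⟨t, ht, v, rfl⟩, ⟨v, mem_compSet_self H' t v⟩,
      (compSet_compSet h v ⟨v, mem_compSet_self H' t v⟩).symm⟩

/-- If a finite graph is covered by pairwise compatible tubes, then all its connected components
are among these tubes. -/
theorem supp_mem_of_cover [Finite V] (hconn : ∀ t ∈ T, (G.induce t).Connected)
    (hcompat : ∀ t ∈ T, ∀ u ∈ T, TubeCompatible G t u) (hcover : ∀ v, ∃ t ∈ T, v ∈ t)
    (c : G.ConnectedComponent) : c.supp ∈ T := by
  induction c using SimpleGraph.ConnectedComponent.ind with | _ v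
  obtain ⟨t₀, ht₀, hvt₀⟩ := hcover v
  obtain ⟨t, ⟨ht, hvt⟩, hmax⟩ :=
    (Set.toFinite {t | t ∈ T ∧ v ∈ t}).exists_maximal ⟨t₀, ht₀, hvt₀⟩
  have hclosed : ∀ a b, G.Adj a b → a ∈ t → b ∈ t := by
    intro a b hab ha
    obtain ⟨u, hu, hbu⟩ := hcover b
    rcases hcompat t ht u hu with htu | hut | hnot
    · exact hmax ⟨hu, htu hvt⟩ htu hbu
    · exact hut hbu
    · exact absurd ⟨⟨v, Or.inl hvt⟩, SimpleGraph.connected_induce_union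
        (hconn t ht).preconnected (hconn u hu).preconnected ha hbu hab⟩ hnot
  have hwalk : ∀ a b, G.Walk a b → a ∈ t → b ∈ t := by
    intro a b p
    induction p with
    | nil => exact id
    | cons hab _ ih => exact fun ha ↦ ih (hclosed _ _ hab ha)
  have hsub : (G.connectedComponentMk v).supp ⊆ t := fun w hw ↦
    (SimpleGraph.ConnectedComponent.exact hw).symm.elim fun p ↦ hwalk v w p hvt
  rwa [(SimpleGraph.ConnectedComponent.maximal_connected_induce_supp _).eq_of_le
    (hconn t ht) hsub]

theorem TubeCompatible.components {t u : Set V} (hle : H ≤ G) (ht : (G.induce t).Connected)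
    (hu : (G.induce u).Connected) (h : TubeCompatible G t u) (v : t) (w : u) :
    TubeCompatible H (compSet H t v) (compSet H u w) := by
  by_cases hcd : IsTube H (compSet H t v ∪ compSet H u w)
  swap
  · exact Or.inr (Or.inr hcd)
  have hv := mem_compSet_self H t v
  have hw := mem_compSet_self H u w
  have hct := compSet_subset H t v
  have hdu := compSet_subset H u w
  rcases h with htu | hut | hnot
  · exact Or.inl (Set.subset_union_left.trans
      (subset_compSet hcd.2 (Set.union_subset (hct.trans htu) hdu) w (Or.inr hw)))
  · exact Or.inr (Or.inl (Set.subset_union_right.trans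
      (subset_compSet hcd.2 (Set.union_subset hct (hdu.trans hut)) v (Or.inl hv))))
  · refine absurd ⟨⟨v, Or.inl v.2⟩, ?_⟩ hnot
    have htcd := SimpleGraph.induce_union_connected ht.preconnected
      (induce_connected_mono hle hcd.2).preconnected ⟨v, v.2, Or.inl hv⟩
    have hall := SimpleGraph.induce_union_connected htcd.preconnected hu.preconnected
      ⟨w, Or.inr (Or.inr hw), w.2⟩
    rwa [← Set.union_assoc, Set.union_eq_left.2 hct, Set.union_assoc,
      Set.union_eq_right.2 hdu] at hall

/-- Passing to a spanning subgraph projects tubings to tubings. -/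
theorem IsTubing.theta [Finite V] (hle : H ≤ G) (hT : IsTubing G T) : IsTubing H (Theta H T) := by
  obtain ⟨htube, hcompat, hcomp⟩ := hT
  refine ⟨?_, ?_, ?_⟩
  · rintro _ ⟨t, ht, v, rfl⟩
    exact ⟨⟨⟨v, mem_compSet_self H t v⟩, compSet_connected H t v⟩, fun h ↦
      (htube t ht).2 (Set.univ_subset_iff.1 (h ▸ compSet_subset H t v))⟩
  · rintro _ ⟨t, ht, v, rfl⟩ _ ⟨u, hu, w, rfl⟩
    exact (hcompat t ht u hu).components hle (htube t ht).1.2 (htube u hu).1.2 v w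
  · intro hH hall
    have hcover : ∀ v, ∃ t ∈ T, v ∈ t := by
      intro v
      obtain ⟨t, ht, w, hw⟩ := hall (H.connectedComponentMk v)
      exact ⟨t, ht, compSet_subset H t w
        (hw ▸ SimpleGraph.ConnectedComponent.connectedComponentMk_mem)⟩
    have hsupp := supp_mem_of_cover (fun t ht ↦ (htube t ht).1.2) hcompat hcover
    by_cases hG : G.Preconnected
    · have : Nonempty V := by
        by_contra hV
        exact hH fun v ↦ absurd ⟨v⟩ hV
      obtain ⟨v⟩ := this
      exact (htube _ (hsupp (G.connectedComponentMk v))).2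
        (Set.eq_univ_of_forall fun w ↦ SimpleGraph.ConnectedComponent.sound (hG w v))
    · exact hcomp hG hsupp

end Theta

/-- The projections `Θ_e` and `Θ_{e'}` commute: applying `Θ_{e'}` and then
`Θ_e` (landing in the graph with both edges deleted) agrees with applying `Θ_e` and then
`Θ_{e'}`, and the result is a tubing of the graph obtained by deleting both edges. -/
theorem theta_comm {V : Type*} [Fintype V] (G : SimpleGraph V)
    (e e' : Sym2 V) (he : e ∈ G.edgeSet) (he' : e' ∈ G.edgeSet)
    (T : Set (Set V)) (hT : IsTubing G T) :
    Theta (G.deleteEdges {e, e'}) (Theta (G.deleteEdges {e'}) T) =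
      Theta (G.deleteEdges {e, e'}) (Theta (G.deleteEdges {e}) T) ∧
    IsTubing (G.deleteEdges {e, e'})
      (Theta (G.deleteEdges {e, e'}) (Theta (G.deleteEdges {e}) T)) := by
  have hle : G.deleteEdges {e, e'} ≤ G.deleteEdges {e} :=
    G.deleteEdges_anti (by simp)
  have hle' : G.deleteEdges {e, e'} ≤ G.deleteEdges {e'} :=
    G.deleteEdges_anti (by simp)
  rw [Theta_Theta hle, Theta_Theta hle']
  exact ⟨rfl, hT.theta (G.deleteEdges_le _)⟩
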